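/- Let each f_i : ℝ^d → ℝ (i = 1,…,n) be convex and L-smooth, let h : ℝ^d → ℝ ∪ {+∞} be proper, lower semicontinuous and convex, set f = (1/n)·Σ_{i=1}^n f_i, F = f + h, and let x* be a minimizer of F with F* = F(x*). Fix x ∈ ℝ^d and reference points w_1, …, w_n ∈ ℝ^d, and for each i define the SAGA stochastic gradient v_i = ∇f_i(x) − ∇f_i(w_i) + (1/n)·Σ_{j=1}^n ∇f_j(w_j), and set ξ = (1/n)·Σ_{i=1}^n ‖∇f_i(w_i) − ∇f_i(x*)‖². Then (1/n)·Σ_{i=1}^n v_i = ∇f(x) and (1/n)·Σ_{i=1}^n ‖v_i − ∇f(x)‖² ≤ 4L·(F(x) − F*) + 2ξ. -/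

import Mathlib

set_option autoImplicit false

open scoped RealInnerProductSpace


theorem aux_min {φ : ℝ → ℝ} {c : ℝ} (hd : HasDerivAt φ c 0)
    (hm : ∀ t : ℝ, 0 < t → t ≤ 1 → φ 0 ≤ φ t) : 0 ≤ c := by
  have ht := hd.tendsto_slope_zero_right
  refine ge_of_tendsto ht ?_
  filter_upwards [Ioc_mem_nhdsGT (zero_lt_one (α := ℝ))] with t ht
  have := hm t ht.1 ht.2
  have h1 : 0 < t⁻¹ := inv_pos.2 ht.1
  rw [zero_add, smul_eq_mul]
  exact mul_nonneg h1.le (by linarith)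

theorem aux_line {E : Type*} [NormedAddCommGroup E] [InnerProductSpace ℝ E] [CompleteSpace E]
    {f : E → ℝ} {f' : E → E} (hg : ∀ x, HasGradientAt f (f' x) x) (x v : E) (t : ℝ) :
    HasDerivAt (fun s : ℝ => f (x + s • v)) ⟪f' (x + t • v), v⟫ t := by
  have h1 : HasDerivAt (fun s : ℝ => x + s • v) v t := by
    simpa using ((hasDerivAt_id t).smul_const v).const_add x
  have h2 := (hg (x + t • v)).hasFDerivAt.comp_hasDerivAt t h1
  simpa [Function.comp_def] using h2

theorem aux_conv {E : Type*} [NormedAddCommGroup E] [InnerProductSpace ℝ E] [CompleteSpace E]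
    {f : E → ℝ} {f' : E → E} (hg : ∀ x, HasGradientAt f (f' x) x)
    (hc : ConvexOn ℝ Set.univ f) (x y : E) : f x + ⟪f' x, y - x⟫ ≤ f y := by
  have h1 := aux_line hg x (y - x) 0
  have h2 : HasDerivAt (fun s : ℝ => s * (f y - f x) - f (x + s • (y - x)))
      ((f y - f x) - ⟪f' x, y - x⟫) 0 := by
    simpa using ((hasDerivAt_id (0:ℝ)).mul_const (f y - f x)).fun_sub h1
  have := aux_min h2 (by
    intro t h0 h1
    have h3 := hc.2 (Set.mem_univ x) (Set.mem_univ y) (sub_nonneg.2 h1) h0.le (by ring)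
    have e : (1 - t) • x + t • y = x + t • (y - x) := by module
    rw [e] at h3
    simp only [smul_eq_mul] at h3
    simp only [zero_mul, zero_smul, add_zero]
    linarith)
  linarith

theorem aux_descent {E : Type*} [NormedAddCommGroup E] [InnerProductSpace ℝ E] [CompleteSpace E]
    {f : E → ℝ} {f' : E → E} {L : ℝ} (hg : ∀ x, HasGradientAt f (f' x) x)
    (hs : ∀ x y, ‖f' x - f' y‖ ≤ L * ‖x - y‖) (x v : E) :
    f (x + v) ≤ f x + ⟪f' x, v⟫ + L / 2 * ‖v‖ ^ 2 := by
  have hd : ∀ t : ℝ, HasDerivAt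
      (fun s : ℝ => f (x + s • v) - s * ⟪f' x, v⟫ - s ^ 2 * (L / 2 * ‖v‖ ^ 2))
      (⟪f' (x + t • v), v⟫ - ⟪f' x, v⟫ - 2 * t * (L / 2 * ‖v‖ ^ 2)) t := by
    intro t
    have := ((aux_line hg x v t).fun_sub ((hasDerivAt_id t).mul_const ⟪f' x, v⟫)).fun_sub
      ((hasDerivAt_pow 2 t).mul_const (L / 2 * ‖v‖ ^ 2))
    simpa using this
  have ha : AntitoneOn
      (fun s : ℝ => f (x + s • v) - s * ⟪f' x, v⟫ - s ^ 2 * (L / 2 * ‖v‖ ^ 2)) (Set.Ici 0) := by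
    apply antitoneOn_of_deriv_nonpos (convex_Ici 0)
    · exact fun t _ => (hd t).continuousAt.continuousWithinAt
    · exact fun t _ => (hd t).differentiableAt.differentiableWithinAt
    · intro t ht
      rw [interior_Ici, Set.mem_Ioi] at ht
      rw [(hd t).deriv, ← inner_sub_left]
      have h1 := real_inner_le_norm (f' (x + t • v) - f' x) v
      have h2 := hs (x + t • v) x
      rw [add_sub_cancel_left, norm_smul, Real.norm_of_nonneg ht.le] at h2
      have h3 := mul_le_mul_of_nonneg_right h2 (norm_nonneg v)
      linarith
  have := ha (Set.mem_Ici.2 le_rfl) (Set.mem_Ici.2 zero_le_one) zero_le_one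
  simp at this
  linarith

theorem aux_coco {E : Type*} [NormedAddCommGroup E] [InnerProductSpace ℝ E] [CompleteSpace E]
    {f : E → ℝ} {f' : E → E} {L : ℝ} (hL : 0 < L) (hg : ∀ x, HasGradientAt f (f' x) x)
    (hc : ConvexOn ℝ Set.univ f)
    (hs : ∀ x y, ‖f' x - f' y‖ ≤ L * ‖x - y‖) (x y : E) :
    ‖f' x - f' y‖ ^ 2 ≤ 2 * L * (f x - f y - ⟪f' y, x - y⟫) := by
  have h1 := aux_descent hg hs x (-(L⁻¹) • (f' x - f' y))
  have h2 := aux_conv hg hc y (x + (-(L⁻¹) • (f' x - f' y)))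
  have e : x + (-(L⁻¹) • (f' x - f' y)) - y = (x - y) + (-(L⁻¹) • (f' x - f' y)) := by abel
  rw [e, inner_add_right, inner_smul_right] at h2
  rw [inner_smul_right, norm_smul, norm_neg, norm_inv, Real.norm_of_nonneg hL.le] at h1
  have e2 : ⟪f' x, f' x - f' y⟫ - ⟪f' y, f' x - f' y⟫ = ‖f' x - f' y‖ ^ 2 := by
    rw [← inner_sub_left, real_inner_self_eq_norm_sq]
  generalize ⟪f' x, f' x - f' y⟫ = a at *
  generalize ⟪f' y, f' x - f' y⟫ = b at *
  generalize ‖f' x - f' y‖ = u at *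
  have h3 : -(L⁻¹) * a + L / 2 * (L⁻¹ * u) ^ 2 + L⁻¹ * b = - (u ^ 2 / (2 * L)) := by
    have : a = u ^ 2 + b := by linarith
    subst this
    field_simp
    ring
  have h4 : u ^ 2 / (2 * L) ≤ f x - f y - ⟪f' y, x - y⟫ := by linarith
  rw [div_le_iff₀ (by positivity)] at h4
  linarith

/-- unbiasedness and variance bound of the SAGA stochastic gradient
`v_i = ∇f_i(x) − ∇f_i(w_i) + (1/n)∑_j ∇f_j(w_j)`:
`(1/n)∑_i v_i = ∇f(x)` and `(1/n)∑_i ‖v_i − ∇f(x)‖² ≤ 4L(F(x) − F*) + 2ξ`,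
where `ξ = (1/n)∑_i ‖∇f_i(w_i) − ∇f_i(x*)‖²`. -/
theorem stmt11 {d n : ℕ} (hn : 0 < n) {L : ℝ} (hL : 0 < L)
    (f : Fin n → EuclideanSpace ℝ (Fin d) → ℝ)
    (f' : Fin n → EuclideanSpace ℝ (Fin d) → EuclideanSpace ℝ (Fin d))
    (hconv : ∀ i, ConvexOn ℝ Set.univ (f i))
    (hgrad : ∀ i x, HasGradientAt (f i) (f' i x) x)
    (hsmooth : ∀ i x y, ‖f' i x - f' i y‖ ≤ L * ‖x - y‖)
    (g : EuclideanSpace ℝ (Fin d) → EuclideanSpace ℝ (Fin d))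
    (hgradf : ∀ x, HasGradientAt (fun y => (1 / (n : ℝ)) * ∑ i, f i y) (g x) x)
    (h : EuclideanSpace ℝ (Fin d) → EReal)
    (hh_proper : ∃ z, h z ≠ ⊤) (hh_ne_bot : ∀ z, h z ≠ ⊥)
    (hh_lsc : LowerSemicontinuous h)
    (hh_convex : ∀ x y : EuclideanSpace ℝ (Fin d), ∀ t : ℝ, 0 ≤ t → t ≤ 1 →
      h (t • x + (1 - t) • y) ≤ (t : EReal) * h x + ((1 - t : ℝ) : EReal) * h y)
    (F : EuclideanSpace ℝ (Fin d) → EReal)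
    (hF : ∀ x, F x = (((1 / (n : ℝ)) * ∑ i, f i x : ℝ) : EReal) + h x)
    (xstar : EuclideanSpace ℝ (Fin d))
    (hmin : ∀ z, F xstar ≤ F z)
    (x : EuclideanSpace ℝ (Fin d))
    (w : Fin n → EuclideanSpace ℝ (Fin d))
    (v : Fin n → EuclideanSpace ℝ (Fin d))
    (hv : ∀ i, v i = f' i x - f' i (w i) + (1 / (n : ℝ)) • ∑ j, f' j (w j))
    (ξ : ℝ)
    (hξ : ξ = (1 / (n : ℝ)) * ∑ i, ‖f' i (w i) - f' i xstar‖ ^ 2) :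
    (1 / (n : ℝ)) • ∑ i, v i = g x ∧
    (((1 / (n : ℝ)) * ∑ i, ‖v i - g x‖ ^ 2 : ℝ) : EReal) ≤
      ((4 * L : ℝ) : EReal) * (F x - F xstar) + ((2 * ξ : ℝ) : EReal) := by
  have hn' : (0:ℝ) < n := Nat.cast_pos.2 hn
  have hgx : ∀ y, g y = (1 / (n : ℝ)) • ∑ i, f' i y := by
    intro y
    refine (hgradf y).unique ?_
    rw [hasGradientAt_iff_hasFDerivAt]
    have := (HasFDerivAt.fun_sum (u := Finset.univ)
      (fun i _ => (hgrad i y).hasFDerivAt)).const_mul (1 / (n : ℝ))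
    convert this using 1
    · rfl
    · simp
  have hmean : (1 / (n : ℝ)) • ∑ i, v i = g x := by
    simp only [hv, hgx, Finset.sum_add_distrib, Finset.sum_sub_distrib, Finset.sum_const,
      Finset.card_univ, Fintype.card_fin, ← Nat.cast_smul_eq_nsmul ℝ, smul_smul]
    rw [mul_one_div_cancel hn'.ne', one_smul]
    congr 1
    abel
  refine ⟨hmean, ?_⟩
  have hFs : F xstar ≠ ⊤ := by
    obtain ⟨z, hz⟩ := hh_proper
    intro ht
    have := hmin z
    rw [ht, top_le_iff, hF] at this
    exact (EReal.add_ne_top (EReal.coe_ne_top _) hz) this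
  have hhs : h xstar ≠ ⊤ := by
    intro ht
    exact hFs (by rw [hF, ht, EReal.coe_add_top])
  by_cases hx : h x = ⊤
  · have h1 : F x = ⊤ := by rw [hF, hx, EReal.coe_add_top]
    rw [h1, EReal.top_sub hFs, EReal.coe_mul_top_of_pos (by positivity), EReal.top_add_coe]
    exact le_top
  lift h x to ℝ using ⟨hx, hh_ne_bot x⟩ with a ha
  lift h xstar to ℝ using ⟨hhs, hh_ne_bot xstar⟩ with b hb
  rw [hF x, hF xstar, ← ha, ← hb]
  norm_cast
  -- optimality
  have hopt : 0 ≤ ⟪g xstar, x - xstar⟫ + (a - b) := by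
    have h1 := aux_line hgradf xstar (x - xstar) 0
    have h2 := h1.add ((hasDerivAt_id (0:ℝ)).mul_const (a - b))
    simp only [zero_smul, add_zero, one_mul] at h2
    refine aux_min h2 ?_
    intro t h0 h1
    have h3 := hmin (xstar + t • (x - xstar))
    have h4 := hh_convex x xstar t h0.le h1
    have e : t • x + (1 - t) • xstar = xstar + t • (x - xstar) := by module
    rw [e, ← ha, ← hb] at h4
    rw [hF, hF, ← hb] at h3
    have h5 := h3.trans (add_le_add_right h4 _)
    norm_cast at h5
    simp only [Pi.add_apply, id, zero_smul, add_zero, zero_mul]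
    linarith
  -- variance
  have hvar : ∑ i, ‖v i - g x‖ ^ 2 ≤ ∑ i, ‖f' i x - f' i (w i)‖ ^ 2 := by
    have hm : ∀ i, f' i x - f' i (w i) = (v i - g x) + (g x - (1 / (n : ℝ)) • ∑ j, f' j (w j)) := by
      intro i; rw [hv]; abel
    have hz : ∑ i, (v i - g x) = 0 := by
      rw [Finset.sum_sub_distrib, Finset.sum_const, Finset.card_univ, Fintype.card_fin,
        ← Nat.cast_smul_eq_nsmul ℝ, ← hmean, smul_smul, mul_one_div_cancel hn'.ne', one_smul,
        sub_self]
    generalize g x - (1 / (n : ℝ)) • ∑ j, f' j (w j) = m at hm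
    simp only [hm, norm_add_sq_real, Finset.sum_add_distrib]
    rw [← Finset.mul_sum, ← sum_inner, hz, inner_zero_left]
    have : 0 ≤ ∑ i : Fin n, ‖m‖ ^ 2 := by positivity
    linarith
  have hb2 : ∀ i, ‖f' i x - f' i (w i)‖ ^ 2 ≤
      4 * L * (f i x - f i xstar - ⟪f' i xstar, x - xstar⟫) + 2 * ‖f' i (w i) - f' i xstar‖ ^ 2 := by
    intro i
    have h1 := aux_coco hL (hgrad i) (hconv i) (hsmooth i) x xstar
    have h2 : ‖f' i x - f' i (w i)‖ ≤ ‖f' i x - f' i xstar‖ + ‖f' i (w i) - f' i xstar‖ := by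
      have := norm_sub_le (f' i x - f' i xstar) (f' i (w i) - f' i xstar)
      rwa [sub_sub_sub_cancel_right] at this
    have h3 := pow_le_pow_left₀ (norm_nonneg _) h2 2
    nlinarith [sq_nonneg (‖f' i x - f' i xstar‖ - ‖f' i (w i) - f' i xstar‖)]
  have hsum := hvar.trans (Finset.sum_le_sum (fun i _ => hb2 i))
  rw [Finset.sum_add_distrib, ← Finset.mul_sum, ← Finset.mul_sum, Finset.sum_sub_distrib,
    Finset.sum_sub_distrib, ← sum_inner] at hsum
  have h6 := mul_le_mul_of_nonneg_left hsum (one_div_pos.2 hn').le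
  rw [hgx, inner_smul_left] at hopt
  simp only [conj_trivial] at hopt
  have h7 := mul_nonneg (by positivity : 0 ≤ 4 * L) hopt
  rw [hξ]
  linarith
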